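/- Let ω be a positive semidefinite matrix on ℂ^{dA} ⊗ ℂ^{dB} and ω' a positive semidefinite matrix on ℂ^{dA'} ⊗ ℂ^{dB'}. Then the support function of the Rains set is sub-multiplicative: h_{Rains(AA':BB')}(ω ⊗ ω') ≤ h_{Rains(A:B)}(ω) · h_{Rains(A':B')}(ω'), where the Kronecker product is reindexed so that the bipartition is (A×A') versus (B×B'). -/

import Mathlib

open scoped Kronecker ComplexOrder Matrix

attribute [local instance] Classical.propDecidable

noncomputable section

namespace QIT

variable {n : Type*} [Fintype n] [DecidableEq n]

/-- Base-2 matrix logarithm taken on the support (junk value `0` for non-Hermitian input). -/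
def matLog (A : Matrix n n ℂ) : Matrix n n ℂ :=
  if hA : A.IsHermitian then
    (hA.eigenvectorUnitary : Matrix n n ℂ) *
      Matrix.diagonal (fun i => if hA.eigenvalues i = 0 then (0 : ℂ)
        else (Real.logb 2 (hA.eigenvalues i) : ℂ)) *
      (hA.eigenvectorUnitary : Matrix n n ℂ)ᴴ
  else 0

/-- Orthogonal projection onto the support of a Hermitian matrix. -/
def suppProj (A : Matrix n n ℂ) : Matrix n n ℂ :=
  if hA : A.IsHermitian then
    (hA.eigenvectorUnitary : Matrix n n ℂ) *
      Matrix.diagonal (fun i => if hA.eigenvalues i = 0 then (0 : ℂ) else 1) *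
      (hA.eigenvectorUnitary : Matrix n n ℂ)ᴴ
  else 0

/-- Support inclusion `supp ρ ⊆ supp σ`, phrased via kernels. -/
def suppLE (ρ σ : Matrix n n ℂ) : Prop :=
  ∀ x : n → ℂ, σ.mulVec x = 0 → ρ.mulVec x = 0

/-- Umegaki relative entropy (base 2), `+∞` when supports are not included. -/
def relEnt (ρ σ : Matrix n n ℂ) : EReal :=
  if suppLE ρ σ then (((ρ * (matLog ρ - matLog σ)).trace).re : EReal) else ⊤

/-- Classical relative-entropy summand `p log₂(p/q)` with conventions
`0 · log(0/q) = 0` and `p · log(p/0) = +∞` for `p ≠ 0`. -/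
def klTerm (p q : ℝ) : EReal :=
  if p = 0 then 0 else if q = 0 then ⊤ else ((p * Real.logb 2 (p / q) : ℝ) : EReal)

/-- A finite POVM. -/
def IsPOVM {m : ℕ} (M : Fin m → Matrix n n ℂ) : Prop :=
  (∀ x, (M x).PosSemidef) ∧ ∑ x, M x = 1

/-- Measured relative entropy (base 2). -/
def measRelEnt (ρ σ : Matrix n n ℂ) : EReal :=
  ⨆ (m : ℕ) (M : Fin m → Matrix n n ℂ) (_ : IsPOVM M),
    ∑ x, klTerm ((M x * ρ).trace).re ((M x * σ).trace).re

/-- Trace norm: sum of singular values. -/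
def traceNorm (A : Matrix n n ℂ) : ℝ :=
  ∑ i, Real.sqrt ((Matrix.posSemidef_conjTranspose_mul_self A).1.eigenvalues i)

/-- Operator (spectral) norm: largest singular value. -/
def opNorm (A : Matrix n n ℂ) : ℝ :=
  ⨆ i, Real.sqrt ((Matrix.posSemidef_conjTranspose_mul_self A).1.eigenvalues i)

/-- Partial transpose on the second tensor factor. -/
def ptB {α β : Type*} (X : Matrix (α × β) (α × β) ℂ) : Matrix (α × β) (α × β) ℂ :=
  Matrix.of fun p q => X (p.1, q.2) (q.1, p.2)

/-- Kronecker product of two bipartite matrices, reindexed to the bipartition (A×A') : (B×B'). -/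
def kron2 {α β γ δ : Type*} (X : Matrix (α × β) (α × β) ℂ) (Y : Matrix (γ × δ) (γ × δ) ℂ) :
    Matrix ((α × γ) × β × δ) ((α × γ) × β × δ) ℂ :=
  Matrix.reindex (Equiv.prodProdProdComm α β γ δ) (Equiv.prodProdProdComm α β γ δ) (X ⊗ₖ Y)

/-- The permutation unitary on `(ℂ^d)^{⊗ m}`. -/
def permMat (d m : ℕ) (π : Equiv.Perm (Fin m)) :
    Matrix (Fin m → Fin d) (Fin m → Fin d) ℂ :=
  Matrix.of fun f g => if f ∘ π = g then 1 else 0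

/-- Membership in the `PPT_k` set. -/
def memPPTk {α β : Type*} [Fintype α] [Fintype β] [DecidableEq α] [DecidableEq β]
    (k : ℕ) (X : Matrix (α × β) (α × β) ℂ) : Prop :=
  X.PosSemidef ∧ ∃ ω : ℕ → Matrix (α × β) (α × β) ℂ,
    ω 1 = X ∧ (∀ i ∈ Finset.Icc 1 k, (ω i).IsHermitian) ∧
    (∀ i ∈ Finset.Icc 1 (k - 1),
      ((ω (i + 1)) - ptB (ω i)).PosSemidef ∧ ((ω (i + 1)) + ptB (ω i)).PosSemidef) ∧
    traceNorm (ptB (ω k)) ≤ 1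

/-- Membership in the Rains set. -/
def memRains {α β : Type*} [Fintype α] [Fintype β] [DecidableEq α] [DecidableEq β]
    (σ : Matrix (α × β) (α × β) ℂ) : Prop :=
  σ.PosSemidef ∧ traceNorm (ptB σ) ≤ 1


/-- Support function of the Rains set. -/
def rainsSuppFn {α β : Type*} [Fintype α] [DecidableEq α] [Fintype β] [DecidableEq β]
    (ω : Matrix (α × β) (α × β) ℂ) : ℝ :=
  sSup {r : ℝ | ∃ σ : Matrix (α × β) (α × β) ℂ, memRains σ ∧ r = ((σ * ω).trace).re}

open scoped Matrix.Norms.L2Operator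

/-- Entries of a matrix are bounded by its spectral norm. -/
theorem norm_entry_le_l2_opNorm (A : Matrix n n ℂ) (i j : n) : ‖A i j‖ ≤ ‖A‖ := by
  have h := A.l2_opNorm_mulVec (EuclideanSpace.single j 1)
  have h2 := PiLp.norm_apply_le (WithLp.toLp 2 (A *ᵥ (EuclideanSpace.single j (1 : ℂ)).ofLp)) i
  simp at h h2
  exact h2.trans h

theorem traceNorm_nonneg (A : Matrix n n ℂ) : 0 ≤ traceNorm A :=
  Finset.sum_nonneg fun _ _ => Real.sqrt_nonneg _

/-- The trace norm of a Hermitian matrix is the sum of the absolute values of its eigenvalues. -/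
theorem traceNorm_eq_sum_abs {A : Matrix n n ℂ} (hA : A.IsHermitian) :
    traceNorm A = ∑ i, |hA.eigenvalues i| := by
  have hB := (Matrix.posSemidef_conjTranspose_mul_self A).1
  have h1 := hB.roots_charpoly_eq_eigenvalues
  have h2 : (Aᴴ * A).charpoly = ∏ i, (Polynomial.X - Polynomial.C ((hA.eigenvalues i ^ 2 : ℝ) : ℂ)) := by
    have : Aᴴ * A = hA.eigenvectorUnitary * (Matrix.diagonal (fun i => ((hA.eigenvalues i ^ 2 : ℝ) : ℂ)) *
        (star hA.eigenvectorUnitary : Matrix n n ℂ)) := by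
      rw [hA.eq]
      conv_lhs => rw [hA.spectral_theorem, ← map_mul, Matrix.diagonal_mul_diagonal]
      rw [Unitary.conjStarAlgAut_apply, mul_assoc]
      simp [pow_two]
    rw [this, Matrix.charpoly_mul_comm, mul_assoc]
    simp [Matrix.charpoly_diagonal]
  rw [h2, Polynomial.roots_prod _ _
    (Finset.prod_ne_zero_iff.mpr fun i _ => Polynomial.X_sub_C_ne_zero _)] at h1
  simp only [Polynomial.roots_X_sub_C, Multiset.bind_singleton] at h1
  have h3 := congrArg (fun s : Multiset ℂ => (s.map (fun z => Real.sqrt z.re)).sum) h1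
  simp only [Multiset.map_map, Function.comp_def, Complex.ofReal_re, Real.sqrt_sq_eq_abs] at h3
  exact h3.symm

/-- Hölder's inequality between trace norm and spectral norm. -/
theorem re_trace_mul_le {A : Matrix n n ℂ} (hA : A.IsHermitian) (Y : Matrix n n ℂ) :
    ((A * Y).trace).re ≤ traceNorm A * ‖Y‖ := by
  set U := hA.eigenvectorUnitary
  set M : Matrix n n ℂ := star (U : Matrix n n ℂ) * Y * U
  have hM : ‖M‖ ≤ ‖Y‖ := by
    simp only [M]
    rw [CStarRing.norm_mul_coe_unitary, ← Unitary.coe_star, CStarRing.norm_coe_unitary_mul]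
  have h : (A * Y).trace = ∑ i, (hA.eigenvalues i : ℂ) * M i i := by
    conv_lhs => rw [hA.spectral_theorem, Unitary.conjStarAlgAut_apply, mul_assoc, mul_assoc,
      Matrix.trace_mul_comm, mul_assoc, mul_assoc]
    simp [Matrix.trace, Matrix.diagonal_mul, M, U, mul_assoc]
  rw [h, traceNorm_eq_sum_abs hA, Complex.re_sum, Finset.sum_mul]
  refine Finset.sum_le_sum fun i _ => (Complex.re_le_norm _).trans ?_
  rw [norm_mul, Complex.norm_real, Real.norm_eq_abs]
  exact mul_le_mul_of_nonneg_left ((norm_entry_le_l2_opNorm M i i).trans hM) (abs_nonneg _)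

/-- Hölder's inequality is attained at the sign of a Hermitian matrix. -/
theorem exists_re_trace_mul_eq_traceNorm {A : Matrix n n ℂ} (hA : A.IsHermitian) :
    ∃ Y : Matrix n n ℂ, ‖Y‖ ≤ 1 ∧ ((A * Y).trace).re = traceNorm A := by
  set U := hA.eigenvectorUnitary
  set D : Matrix n n ℂ := Matrix.diagonal fun i => (SignType.sign (hA.eigenvalues i) : ℂ)
  refine ⟨Unitary.conjStarAlgAut ℂ _ U D, ?_, ?_⟩
  · rw [Unitary.conjStarAlgAut_apply, ← Unitary.coe_star, CStarRing.norm_mul_coe_unitary,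
      CStarRing.norm_coe_unitary_mul, Matrix.l2_opNorm_diagonal, pi_norm_le_iff_of_nonneg zero_le_one]
    intro i
    rcases SignType.sign (hA.eigenvalues i) <;> simp
  · conv_lhs => rw [hA.spectral_theorem, ← map_mul, Matrix.diagonal_mul_diagonal,
      Unitary.conjStarAlgAut_apply, mul_assoc, Matrix.trace_mul_comm, mul_assoc]
    simp only [Unitary.coe_star_mul_self, mul_one, Matrix.trace_diagonal, Complex.re_sum, Function.comp]
    rw [traceNorm_eq_sum_abs hA]
    refine Finset.sum_congr rfl fun i _ => ?_
    rcases lt_trichotomy (hA.eigenvalues i) 0 with h | h | h <;> simp [h, abs_of_neg, abs_of_pos]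

theorem traceNorm_smul_le {A : Matrix n n ℂ} (hA : A.IsHermitian) {c : ℝ} (hc : 0 ≤ c) :
    traceNorm (c • A) ≤ c * traceNorm A := by
  have hcA : (c • A).IsHermitian := by simp [Matrix.IsHermitian, hA.eq]
  obtain ⟨Y, hY, h⟩ := exists_re_trace_mul_eq_traceNorm hcA
  rw [← h, smul_mul_assoc, Matrix.trace_smul, Complex.smul_re, smul_eq_mul]
  exact mul_le_mul_of_nonneg_left
    ((re_trace_mul_le hA Y).trans (mul_le_of_le_one_right (traceNorm_nonneg A) hY)) hc

theorem re_trace_mul_nonneg {A B : Matrix n n ℂ} (hA : A.PosSemidef) (hB : B.PosSemidef) :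
    0 ≤ ((A * B).trace).re := by
  open scoped MatrixOrder in
  obtain ⟨C, rfl⟩ := CStarAlgebra.nonneg_iff_eq_star_mul_self.mp hB.nonneg
  rw [Matrix.star_eq_conjTranspose, ← mul_assoc, Matrix.trace_mul_comm, ← mul_assoc]
  exact (Complex.nonneg_iff.mp (hA.mul_mul_conjTranspose_same C).trace_nonneg).1

theorem convex_setOf_sub_posSemidef {m : Type*} (ω : Matrix m m ℂ) :
    Convex ℝ {X : Matrix m m ℂ | (X - ω).PosSemidef} := by
  intro X hX Y hY a b ha hb hab
  have h : a • X + b • Y - ω = a • (X - ω) + b • (Y - ω) := by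
    rw [smul_sub, smul_sub, sub_add_sub_comm, ← add_smul, hab, one_smul]
  simp only [Set.mem_ofPred_eq] at *
  rw [h]
  exact (hX.smul ha).add (hY.smul hb)

theorem isClosed_setOf_sub_posSemidef {m : Type*} [Fintype m] (ω : Matrix m m ℂ) :
    IsClosed {X : Matrix m m ℂ | (X - ω).PosSemidef} := by
  simp only [Matrix.posSemidef_iff_dotProduct_mulVec, Matrix.IsHermitian, Set.ofPred_and,
    Set.ofPred_forall]
  refine (isClosed_eq (by fun_prop) (by fun_prop)).inter (isClosed_iInter fun x => ?_)
  exact isClosed_Ici.preimage (f := fun X : Matrix m m ℂ => star x ⬝ᵥ (X - ω) *ᵥ x) (by fun_prop)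

/-- Every linear functional on matrices is of the form `X ↦ tr (σ X)`. -/
theorem exists_trace_mul_eq (f : Matrix n n ℂ →ₗ[ℂ] ℂ) :
    ∃ σ : Matrix n n ℂ, ∀ X, f X = (σ * X).trace := by
  refine ⟨Matrix.of fun i j => f (Matrix.single j i 1), fun X => ?_⟩
  conv_lhs => rw [Matrix.matrix_eq_sum_single X]
  simp only [map_sum, Matrix.trace, Matrix.diag, Matrix.mul_apply, Matrix.of_apply]
  rw [Finset.sum_comm]
  refine Finset.sum_congr rfl fun i _ => Finset.sum_congr rfl fun j _ => ?_
  rw [← mul_one (X j i), ← smul_eq_mul, ← Matrix.smul_single, map_smul]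
  simp [mul_comm]

section PartialTranspose

variable {α β γ δ : Type*}

theorem conjTranspose_ptB (X : Matrix (α × β) (α × β) ℂ) : (ptB X)ᴴ = ptB Xᴴ := rfl

theorem ptB_ptB (X : Matrix (α × β) (α × β) ℂ) : ptB (ptB X) = X := rfl

theorem _root_.Matrix.IsHermitian.ptB {X : Matrix (α × β) (α × β) ℂ} (hX : X.IsHermitian) :
    (ptB X).IsHermitian := by
  rw [Matrix.IsHermitian, conjTranspose_ptB, hX.eq]

theorem ptB_kron2 (X : Matrix (α × β) (α × β) ℂ) (Y : Matrix (γ × δ) (γ × δ) ℂ) :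
    ptB (kron2 X Y) = kron2 (ptB X) (ptB Y) := rfl

/-- The partial transpose as a linear map. -/
def ptBₗ : Matrix (α × β) (α × β) ℂ →ₗ[ℝ] Matrix (α × β) (α × β) ℂ where
  toFun := ptB
  map_add' _ _ := rfl
  map_smul' _ _ := rfl

variable [Fintype α] [Fintype β] [Fintype γ] [Fintype δ]

theorem trace_mul_ptB (X Y : Matrix (α × β) (α × β) ℂ) :
    (X * ptB Y).trace = (ptB X * Y).trace := by
  simp only [Matrix.trace, Matrix.diag, Matrix.mul_apply, ptB, Matrix.of_apply,
    Fintype.sum_prod_type]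
  refine Finset.sum_congr rfl fun a _ => ?_
  rw [Finset.sum_comm]
  conv_rhs => rw [Finset.sum_comm]
  refine Finset.sum_congr rfl fun a' _ => ?_
  rw [Finset.sum_comm]

theorem posSemidef_kron2_sub_kron2 {X ω : Matrix (α × β) (α × β) ℂ}
    {Y ω' : Matrix (γ × δ) (γ × δ) ℂ} (hω : ω.PosSemidef) (hω' : ω'.PosSemidef)
    (hX : (X - ω).PosSemidef) (hY : (Y - ω').PosSemidef) :
    (kron2 X Y - kron2 ω ω').PosSemidef := by
  have hY' : Y.PosSemidef := by simpa using hY.add hω'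
  have h : X ⊗ₖ Y - ω ⊗ₖ ω' = (X - ω) ⊗ₖ Y + ω ⊗ₖ (Y - ω') := by
    ext i j; simp [Matrix.kroneckerMap_apply]; ring
  have h2 : (X ⊗ₖ Y - ω ⊗ₖ ω').PosSemidef := h ▸ (hX.kronecker hY').add (hω.kronecker hY)
  exact h2.submatrix _

variable [DecidableEq α] [DecidableEq β] [DecidableEq γ] [DecidableEq δ]

theorem norm_kron2_one_le (X : Matrix (α × β) (α × β) ℂ) :
    ‖kron2 X (1 : Matrix (γ × δ) (γ × δ) ℂ)‖ ≤ ‖X‖ := by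
  let φ : Matrix (α × β) (α × β) ℂ →⋆ₙₐ[ℂ] Matrix ((α × γ) × β × δ) ((α × γ) × β × δ) ℂ :=
    { toFun := fun X => kron2 X 1
      map_smul' := fun c X => by simp [kron2, Matrix.smul_kronecker]; rfl
      map_zero' := by simp [kron2]
      map_add' := fun X Y => by simp [kron2, Matrix.add_kronecker]; rfl
      map_mul' := fun X Y => by
        simp [kron2, ← Matrix.mul_kronecker_mul]
      map_star' := fun X => by
        simp [kron2, Matrix.star_eq_conjTranspose, Matrix.conjTranspose_kronecker] }
  exact NonUnitalStarAlgHom.norm_apply_le φ X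

theorem norm_one_kron2_le (Y : Matrix (γ × δ) (γ × δ) ℂ) :
    ‖kron2 (1 : Matrix (α × β) (α × β) ℂ) Y‖ ≤ ‖Y‖ := by
  let φ : Matrix (γ × δ) (γ × δ) ℂ →⋆ₙₐ[ℂ] Matrix ((α × γ) × β × δ) ((α × γ) × β × δ) ℂ :=
    { toFun := fun Y => kron2 1 Y
      map_smul' := fun c X => by simp [kron2, Matrix.kronecker_smul]; rfl
      map_zero' := by simp [kron2]
      map_add' := fun X Y => by simp [kron2, Matrix.kronecker_add]; rfl
      map_mul' := fun X Y => by
        simp [kron2, ← Matrix.mul_kronecker_mul]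
      map_star' := fun X => by
        simp [kron2, Matrix.star_eq_conjTranspose, Matrix.conjTranspose_kronecker] }
  exact NonUnitalStarAlgHom.norm_apply_le φ Y

theorem norm_kron2_le (X : Matrix (α × β) (α × β) ℂ) (Y : Matrix (γ × δ) (γ × δ) ℂ) :
    ‖kron2 X Y‖ ≤ ‖X‖ * ‖Y‖ := by
  have h : kron2 X Y = kron2 X 1 * kron2 1 Y := by
    simp [kron2, ← Matrix.mul_kronecker_mul]
  rw [h]
  exact (norm_mul_le _ _).trans
    (mul_le_mul (norm_kron2_one_le X) (norm_one_kron2_le Y) (norm_nonneg _) (norm_nonneg _))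

/-- Weak duality for the support function of the Rains set. -/
theorem re_trace_mul_le_of_memRains {σ ω Y : Matrix (α × β) (α × β) ℂ} (hσ : memRains σ)
    (hY : (ptB Y - ω).PosSemidef) : ((σ * ω).trace).re ≤ ‖Y‖ := by
  have h1 := re_trace_mul_nonneg hσ.1 hY
  rw [mul_sub, Matrix.trace_sub, Complex.sub_re, trace_mul_ptB] at h1
  have h2 := re_trace_mul_le hσ.1.1.ptB Y
  have h3 := mul_le_of_le_one_left (norm_nonneg Y) hσ.2
  linarith

theorem re_trace_mul_le_rainsSuppFn {σ : Matrix (α × β) (α × β) ℂ} (hσ : memRains σ)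
    (ω : Matrix (α × β) (α × β) ℂ) : ((σ * ω).trace).re ≤ rainsSuppFn ω := by
  refine le_csSup ⟨‖ptB ω‖, ?_⟩ ⟨σ, hσ, rfl⟩
  rintro _ ⟨τ, hτ, rfl⟩
  exact re_trace_mul_le_of_memRains hτ (by simpa [ptB_ptB] using Matrix.PosSemidef.zero)

theorem memRains_zero : memRains (0 : Matrix (α × β) (α × β) ℂ) := by
  refine ⟨.zero, ?_⟩
  have h := traceNorm_smul_le (A := (0 : Matrix (α × β) (α × β) ℂ)) (by simp) le_rfl
  rw [smul_zero, zero_mul] at h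
  exact h.trans zero_le_one

theorem rainsSuppFn_nonneg (ω : Matrix (α × β) (α × β) ℂ) : 0 ≤ rainsSuppFn ω := by
  simpa using re_trace_mul_le_rainsSuppFn memRains_zero ω

theorem re_trace_mul_le_rainsSuppFn_mul_traceNorm {τ : Matrix (α × β) (α × β) ℂ}
    (hτ : τ.PosSemidef) (ω : Matrix (α × β) (α × β) ℂ) :
    ((τ * ω).trace).re ≤ rainsSuppFn ω * traceNorm (ptB τ) := by
  have h0 : 0 ≤ traceNorm (ptB τ) := traceNorm_nonneg _
  rcases h0.eq_or_lt with h | h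
  · rw [← h, mul_zero]
    have := re_trace_mul_le hτ.1.ptB (ptB ω)
    rwa [← trace_mul_ptB, ptB_ptB, ← h, zero_mul] at this
  · set c := (traceNorm (ptB τ))⁻¹
    have hc : 0 ≤ c := inv_nonneg.mpr h0
    have hmem : memRains (c • τ) :=
      ⟨hτ.smul hc, (traceNorm_smul_le hτ.1.ptB hc).trans (inv_mul_cancel₀ h.ne').le⟩
    have := re_trace_mul_le_rainsSuppFn hmem ω
    rw [smul_mul_assoc, Matrix.trace_smul, Complex.smul_re, smul_eq_mul] at this
    rw [← div_le_iff₀ h]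
    rwa [div_eq_inv_mul]

/-- Strong duality, with attainment, for the support function of the Rains set. -/
theorem exists_norm_le_rainsSuppFn {ω : Matrix (α × β) (α × β) ℂ} (hω : ω.IsHermitian) :
    ∃ Y : Matrix (α × β) (α × β) ℂ, ‖Y‖ ≤ rainsSuppFn ω ∧ (ptB Y - ω).PosSemidef := by
  by_contra! hcon
  have ht := rainsSuppFn_nonneg ω
  set t := rainsSuppFn ω
  have hdisj : Disjoint (ptBₗ '' Metric.closedBall (0 : Matrix (α × β) (α × β) ℂ) t)
      {X | (X - ω).PosSemidef} := by
    rw [Set.disjoint_left]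
    rintro _ ⟨Y, hY, rfl⟩
    exact hcon Y (mem_closedBall_zero_iff.mp hY)
  have : ProperSpace (Matrix (α × β) (α × β) ℂ) := FiniteDimensional.proper ℂ _
  obtain ⟨f, u, v, hu, huv, hv⟩ := RCLike.geometric_hahn_banach_compact_closed (𝕜 := ℂ)
    ((convex_closedBall _ _).linear_image ptBₗ)
    ((isCompact_closedBall _ _).image (ptBₗ (α := α) (β := β)).continuous_of_finiteDimensional)
    (convex_setOf_sub_posSemidef ω) (isClosed_setOf_sub_posSemidef ω) hdisj
  obtain ⟨σ, hσ⟩ := exists_trace_mul_eq (f : Matrix (α × β) (α × β) ℂ →ₗ[ℂ] ℂ)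
  simp only [ContinuousLinearMap.coe_coe] at hσ
  set τ : Matrix (α × β) (α × β) ℂ := (2⁻¹ : ℝ) • (σ + σᴴ)
  have hτh : τ.IsHermitian := by simp [τ, Matrix.IsHermitian, add_comm]
  have hτtr (X : Matrix (α × β) (α × β) ℂ) :
      ((τ * X).trace).re = ((f X).re + (f Xᴴ).re) / 2 := by
    have h : (σᴴ * X).trace = star (σ * Xᴴ).trace := by
      rw [← Matrix.trace_conjTranspose, Matrix.conjTranspose_mul, Matrix.conjTranspose_conjTranspose,
        Matrix.trace_mul_comm]
    simp only [τ, smul_mul_assoc, add_mul, Matrix.trace_smul, Matrix.trace_add, h, hσ]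
    simp
    ring
  have hτ : τ.PosSemidef := by
    refine .of_dotProduct_mulVec_nonneg hτh fun x => ?_
    have hpos {P : Matrix (α × β) (α × β) ℂ} (hP : P.PosSemidef) : 0 ≤ (f P).re := by
      by_contra! hneg
      obtain ⟨k, hk⟩ := exists_nat_gt (((f ω).re - v) / -(f P).re)
      rw [div_lt_iff₀ (by linarith)] at hk
      have := hv (ω + (k : ℝ) • P) (by simpa using hP.smul (Nat.cast_nonneg (α := ℝ) k))
      rw [map_add, (f : Matrix (α × β) (α × β) ℂ →L[ℂ] ℂ).map_smul_of_tower] at this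
      simp at this
      linarith
    have hP := Matrix.posSemidef_vecMulVec_self_star x
    have hre := hτtr (Matrix.vecMulVec x (star x))
    rw [hP.1.eq, Matrix.mul_vecMulVec, Matrix.trace_vecMulVec, dotProduct_comm] at hre
    refine Complex.nonneg_iff.mpr ⟨?_, (hτh.im_star_dotProduct_mulVec_self x).symm⟩
    linarith [hpos hP]
  obtain ⟨Y, hY, hYτ⟩ := exists_re_trace_mul_eq_traceNorm hτ.1.ptB
  have hfY {Z : Matrix (α × β) (α × β) ℂ} (hZ : ‖Z‖ ≤ 1) : (f (ptB (t • Z))).re < u := by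
    refine hu _ ⟨t • Z, ?_, rfl⟩
    rw [mem_closedBall_zero_iff, norm_smul, Real.norm_of_nonneg ht]
    exact mul_le_of_le_one_right ht hZ
  have h1 := hτtr (ptB (t • Y))
  rw [trace_mul_ptB, mul_smul_comm, Matrix.trace_smul, Complex.smul_re, hYτ, smul_eq_mul,
    conjTranspose_ptB, Matrix.conjTranspose_smul, star_trivial] at h1
  have h2 := hfY hY
  have h3 := hfY ((Matrix.l2_opNorm_conjTranspose Y).trans_le hY)
  have h4 := hτtr ω
  rw [hω.eq] at h4
  have h5 := hv ω (by simpa using Matrix.PosSemidef.zero)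
  have h6 := re_trace_mul_le_rainsSuppFn_mul_traceNorm hτ ω
  simp only [RCLike.re_eq_complex_re] at h5
  linarith

end PartialTranspose

/-- sub-multiplicativity of the support function of the Rains set. -/
theorem rains_suppFn_submultiplicative {dA dB dA' dB' : ℕ}
    (ω : Matrix (Fin dA × Fin dB) (Fin dA × Fin dB) ℂ)
    (ω' : Matrix (Fin dA' × Fin dB') (Fin dA' × Fin dB') ℂ)
    (hω : ω.PosSemidef) (hω' : ω'.PosSemidef) :
    rainsSuppFn (kron2 ω ω') ≤ rainsSuppFn ω * rainsSuppFn ω' := by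
  obtain ⟨Y, hY, hYω⟩ := exists_norm_le_rainsSuppFn hω.1
  obtain ⟨Y', hY', hYω'⟩ := exists_norm_le_rainsSuppFn hω'.1
  refine csSup_le ⟨_, 0, memRains_zero, rfl⟩ ?_
  rintro _ ⟨σ, hσ, rfl⟩
  have h := posSemidef_kron2_sub_kron2 hω hω' hYω hYω'
  rw [← ptB_kron2] at h
  exact (re_trace_mul_le_of_memRains hσ h).trans ((norm_kron2_le Y Y').trans
    (mul_le_mul hY hY' (norm_nonneg _) (rainsSuppFn_nonneg ω)))

end QIT
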